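/- Let d = 1 and let X_1, …, X_n be independent real-valued random variables under Ê with sup_{P ∈ 𝒫} E_P[X_i²] < ∞ for each i. Set μ₊ := (1/n)∑_{i=1}^n Ê[X_i], μ₋ := −(1/n)∑_{i=1}^n Ê[−X_i], and S̄ := (1/n)∑_{i=1}^n X_i. Then Ê[ ((S̄ − μ₊)⁺ + (S̄ − μ₋)⁻)² ] ≤ σ̄_n²/n, where σ̄_n² := max_{i ≤ n} inf_{θ ∈ [−Ê[−X_i], Ê[X_i]]} Ê[|X_i − θ|²], x⁺ := max(x, 0) and x⁻ := max(−x, 0). -/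

import Mathlib

open MeasureTheory Set
open scoped NNReal ENNReal RealInnerProductSpace

noncomputable section

/-- Bounded Lipschitz real-valued function on a (pseudo)metric space. -/
def IsBLip {α : Type*} [PseudoMetricSpace α] (ψ : α → ℝ) : Prop :=
  (∃ K : ℝ≥0, LipschitzWith K ψ) ∧ ∃ C : ℝ, ∀ x, |ψ x| ≤ C

variable {Ω : Type*} [MeasurableSpace Ω] [TopologicalSpace Ω]

/-- The sublinear expectation `Ê[f] = sup_{P ∈ Pset} E_P[f]`. -/
def hatE (Pset : Set (ProbabilityMeasure Ω)) (f : Ω → ℝ) : ℝ :=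
  ⨆ P : Pset, ∫ ω, f ω ∂((P : ProbabilityMeasure Ω) : Measure Ω)

/-- Convexity of a set of probability measures. -/
def ConvexPM (Pset : Set (ProbabilityMeasure Ω)) : Prop :=
  ∀ P ∈ Pset, ∀ Q ∈ Pset, ∀ a : ℝ≥0, a ≤ 1 →
    ∃ R ∈ Pset, (R : Measure Ω)
      = (a : ℝ≥0∞) • (P : Measure Ω) + ((1 - a : ℝ≥0) : ℝ≥0∞) • (Q : Measure Ω)

/-- `σ(X_1, …, X_i)` for a finite family of `ℝ^d`-valued maps (0-indexed:
`F X i` is generated by `X 0, …, X (i-1)`; `F X 0` is trivial). -/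
def sigmaF {d n : ℕ} (X : Fin n → Ω → EuclideanSpace ℝ (Fin d)) (i : ℕ) :
    MeasurableSpace Ω :=
  ⨆ j : Fin n, ⨆ _ : (j : ℕ) < i, MeasurableSpace.comap (X j) (borel _)

/-- Independence of `X_1, …, X_n` (0-indexed) under the sublinear expectation
associated with `Pset`. -/
def IndepUnder (Pset : Set (ProbabilityMeasure Ω)) {d n : ℕ}
    (X : Fin n → Ω → EuclideanSpace ℝ (Fin d)) : Prop :=
  ∀ (i : ℕ) (hi : i + 1 < n)
    (ψ : ((Fin (i + 1) → EuclideanSpace ℝ (Fin d)) × EuclideanSpace ℝ (Fin d)) → ℝ),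
    IsBLip ψ →
    hatE Pset (fun ω => ψ ((fun j => X ⟨j.1, lt_trans j.2 hi⟩ ω), X ⟨i + 1, hi⟩ ω))
      = hatE Pset (fun ω =>
          hatE Pset (fun ω' => ψ ((fun j => X ⟨j.1, lt_trans j.2 hi⟩ ω), X ⟨i + 1, hi⟩ ω')))

/-- Uniformly bounded second moments over `Pset`. -/
def HasBddMoment2 (Pset : Set (ProbabilityMeasure Ω)) {d : ℕ}
    (X : Ω → EuclideanSpace ℝ (Fin d)) : Prop :=
  ∃ C : ℝ, ∀ P ∈ Pset, Integrable (fun ω => ‖X ω‖ ^ 2) (P : Measure Ω) ∧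
    ∫ ω, ‖X ω‖ ^ 2 ∂(P : Measure Ω) ≤ C

/-- `Θ_X = {θ : ⟨θ, p⟩ ≤ Ê[⟨p, X⟩] for all p}`. -/
def ThetaSet (Pset : Set (ProbabilityMeasure Ω)) {d : ℕ}
    (X : Ω → EuclideanSpace ℝ (Fin d)) : Set (EuclideanSpace ℝ (Fin d)) :=
  {θ | ∀ p : EuclideanSpace ℝ (Fin d), ⟪θ, p⟫ ≤ hatE Pset (fun ω => ⟪p, X ω⟫)}

/-- Independence of real-valued `X_1, …, X_n` (0-indexed) under the sublinear
expectation associated with `Pset`. -/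
def IndepUnderR {Ω : Type*} [MeasurableSpace Ω] [TopologicalSpace Ω]
    (Pset : Set (ProbabilityMeasure Ω)) {n : ℕ} (X : Fin n → Ω → ℝ) : Prop :=
  ∀ (i : ℕ) (hi : i + 1 < n) (ψ : ((Fin (i + 1) → ℝ) × ℝ) → ℝ),
    IsBLip ψ →
    hatE Pset (fun ω => ψ ((fun j => X ⟨j.1, lt_trans j.2 hi⟩ ω), X ⟨i + 1, hi⟩ ω))
      = hatE Pset (fun ω =>
          hatE Pset (fun ω' => ψ ((fun j => X ⟨j.1, lt_trans j.2 hi⟩ ω), X ⟨i + 1, hi⟩ ω')))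

/-- The distance from `s` to the interval `[A, B]`. -/
def intervalDist (A B s : ℝ) : ℝ :=
  max (s - B) 0 + max (-(s - A)) 0

lemma intervalDist_nonneg (A B s : ℝ) : 0 ≤ intervalDist A B s :=
  add_nonneg (le_max_right _ _) (le_max_right _ _)

lemma intervalDist_le {A B c : ℝ} (hA : A ≤ c) (hB : c ≤ B) (s : ℝ) :
    intervalDist A B s ≤ |s - c| := by
  unfold intervalDist
  rcases max_cases (s - B) 0 with h | h <;> rcases max_cases (-(s - A)) 0 with h' | h' <;>
    rcases abs_cases (s - c) with h'' | h'' <;> linarith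

lemma exists_intervalDist_eq {A B : ℝ} (hAB : A ≤ B) (s : ℝ) :
    ∃ c, A ≤ c ∧ c ≤ B ∧ intervalDist A B s = |s - c| := by
  unfold intervalDist
  rcases le_total s A with h | h
  · refine ⟨A, le_rfl, hAB, ?_⟩
    rw [max_eq_right (by linarith), max_eq_left (by linarith), abs_of_nonpos (by linarith), zero_add]
  · rcases le_total s B with h' | h'
    · refine ⟨s, h, h', ?_⟩
      rw [max_eq_right (by linarith), max_eq_right (by linarith)]
      simp
    · refine ⟨B, hAB, le_rfl, ?_⟩
      rw [max_eq_left (by linarith), max_eq_right (by linarith), abs_of_nonneg (by linarith),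
        add_zero]

lemma intervalDist_le_add {A B : ℝ} (hAB : A ≤ B) (s t : ℝ) :
    intervalDist A B s ≤ intervalDist A B t + |s - t| := by
  obtain ⟨c, hA, hB, hc⟩ := exists_intervalDist_eq hAB t
  have h := intervalDist_le hA hB s
  have h' := abs_sub_le s t c
  linarith

lemma continuous_intervalDist (A B : ℝ) : Continuous (intervalDist A B) := by
  unfold intervalDist
  fun_prop

lemma abs_min_intervalDist_sq_sub_le {A B M : ℝ} (hAB : A ≤ B) (hM : 0 ≤ M) (s t : ℝ) :
    |min (intervalDist A B s) M ^ 2 - min (intervalDist A B t) M ^ 2| ≤ 2 * M * |s - t| := by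
  have h1 : |min (intervalDist A B s) M - min (intervalDist A B t) M| ≤ |s - t| := by
    refine (abs_min_sub_min_le_max _ _ _ _).trans (max_le ?_ (by simp))
    rw [abs_le]
    have := intervalDist_le_add hAB s t
    have := intervalDist_le_add hAB t s
    rw [abs_sub_comm t s] at this
    constructor <;> linarith
  have h2 : |min (intervalDist A B s) M + min (intervalDist A B t) M| ≤ 2 * M := by
    have := intervalDist_nonneg A B s
    have := intervalDist_nonneg A B t
    rw [abs_of_nonneg (by positivity)]
    linarith [min_le_right (intervalDist A B s) M, min_le_right (intervalDist A B t) M]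
  rw [sq_sub_sq, abs_mul]
  gcongr

lemma isBLip_min_intervalDist_sq {A B M : ℝ} (hAB : A ≤ B) (hM : 0 ≤ M) (k : ℕ) :
    IsBLip (fun p : (Fin k → ℝ) × ℝ => min (intervalDist A B (∑ j, p.1 j + p.2)) M ^ 2) := by
  refine ⟨⟨⟨2 * M * (k + 1), by positivity⟩, LipschitzWith.of_dist_le_mul fun p q => ?_⟩,
    M ^ 2, fun p => ?_⟩
  · rw [Real.dist_eq]
    refine (abs_min_intervalDist_sq_sub_le hAB hM _ _).trans ?_
    change _ ≤ 2 * M * (k + 1) * dist p q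
    rw [mul_assoc (2 * M)]
    refine mul_le_mul_of_nonneg_left ?_ (by positivity)
    have h1 : ∀ j, |p.1 j - q.1 j| ≤ dist p q := fun j =>
      (dist_le_pi_dist p.1 q.1 j).trans (le_max_left _ _)
    have h2 : |p.2 - q.2| ≤ dist p q := le_max_right _ _
    calc |∑ j, p.1 j + p.2 - (∑ j, q.1 j + q.2)|
        = |∑ j, (p.1 j - q.1 j) + (p.2 - q.2)| := by
          rw [Finset.sum_sub_distrib]; ring_nf
      _ ≤ ∑ j, |p.1 j - q.1 j| + |p.2 - q.2| :=
          (abs_add_le _ _).trans (add_le_add_left (Finset.abs_sum_le_sum_abs _ _) _)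
      _ ≤ ∑ _j : Fin k, dist p q + dist p q := by
          gcongr with j
          exact h1 j
      _ = (k + 1) * dist p q := by simp; ring
  · have h := intervalDist_nonneg A B (∑ j, p.1 j + p.2)
    rw [abs_of_nonneg (by positivity)]
    exact pow_le_pow_left₀ (le_min h hM) (min_le_right _ _) 2

lemma integral_le_hatE {Ω : Type*} [MeasurableSpace Ω] {Pset : Set (ProbabilityMeasure Ω)} {f : Ω → ℝ} {C : ℝ}
    (hC : ∀ P ∈ Pset, ∫ ω, f ω ∂(P : Measure Ω) ≤ C)
    {P : ProbabilityMeasure Ω} (hP : P ∈ Pset) :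
    ∫ ω, f ω ∂(P : Measure Ω) ≤ hatE Pset f :=
  le_ciSup (f := fun P : Pset => ∫ ω, f ω ∂((P : ProbabilityMeasure Ω) : Measure Ω))
    ⟨C, by rintro _ ⟨Q, rfl⟩; exact hC Q Q.2⟩ ⟨P, hP⟩

lemma hatE_le {Ω : Type*} [MeasurableSpace Ω] {Pset : Set (ProbabilityMeasure Ω)} (hne : Pset.Nonempty) {f : Ω → ℝ} {C : ℝ}
    (hC : ∀ P ∈ Pset, ∫ ω, f ω ∂(P : Measure Ω) ≤ C) : hatE Pset f ≤ C := by
  have := hne.to_subtype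
  exact ciSup_le fun P => hC P P.2

lemma hatE_nonneg {Ω : Type*} [MeasurableSpace Ω] {Pset : Set (ProbabilityMeasure Ω)} {f : Ω → ℝ} (hf : ∀ ω, 0 ≤ f ω) :
    0 ≤ hatE Pset f :=
  Real.iSup_nonneg fun _ => integral_nonneg hf

section Moments

variable {α : Type*} [MeasurableSpace α] {P : Measure α} [IsProbabilityMeasure P] {X : α → ℝ}

lemma integral_centered_add_sq (hX : MemLp X 2 P) (c : ℝ) :
    ∫ ω, (X ω - ∫ x, X x ∂P + c) ^ 2 ∂P = ∫ ω, (X ω - ∫ x, X x ∂P) ^ 2 ∂P + c ^ 2 := by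
  set m := ∫ x, X x ∂P with hm
  have hi : Integrable (fun ω => X ω - m) P :=
    (hX.integrable one_le_two).sub (integrable_const m)
  have hs : Integrable (fun ω => (X ω - m) ^ 2) P := (hX.sub (memLp_const m)).integrable_sq
  have h0 : ∫ ω, (X ω - m) ∂P = 0 := by
    rw [integral_sub (hX.integrable one_le_two) (integrable_const m)]
    simp [hm]
  have : ∀ ω, (X ω - m + c) ^ 2 = (X ω - m) ^ 2 + (2 * c * (X ω - m) + c ^ 2) :=
    fun ω => by ring
  simp_rw [this]
  have hl : Integrable (fun ω => 2 * c * (X ω - m)) P := hi.const_mul _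
  have hr : Integrable (fun ω => 2 * c * (X ω - m) + c ^ 2) P := hl.add (integrable_const _)
  rw [integral_add hs hr,
    integral_add hl (integrable_const _), integral_const_mul, h0]
  simp

lemma integrable_intervalDist_sq (hX : MemLp X 2 P) {A B : ℝ} (hAB : A ≤ B) :
    Integrable (fun ω => intervalDist A B (X ω) ^ 2) P := by
  refine Integrable.mono' (hX.sub (memLp_const A)).integrable_sq
    (((continuous_intervalDist A B).pow 2).comp_aestronglyMeasurable hX.1)
    (Filter.Eventually.of_forall fun ω => ?_)
  rw [Real.norm_of_nonneg (sq_nonneg _)]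
  change _ ≤ (X ω - A) ^ 2
  rw [← sq_abs (X ω - A)]
  have := intervalDist_nonneg A B (X ω)
  gcongr
  exact intervalDist_le le_rfl hAB _

/-- Shifting by a square-integrable variable with mean in `[a, b]` increases the mean squared
distance to the interval, shifted accordingly, by at most the variance. -/
lemma integral_intervalDist_add_sq_le (hX : MemLp X 2 P) {a b A B : ℝ}
    (ha : a ≤ ∫ ω, X ω ∂P) (hb : ∫ ω, X ω ∂P ≤ b) (hAB : A ≤ B) (s : ℝ) :
    ∫ ω, intervalDist (A + a) (B + b) (s + X ω) ^ 2 ∂P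
      ≤ intervalDist A B s ^ 2 + ∫ ω, (X ω - ∫ x, X x ∂P) ^ 2 ∂P := by
  obtain ⟨c, hA, hB, hc⟩ := exists_intervalDist_eq hAB s
  rw [hc, sq_abs, add_comm (_ ^ 2), ← integral_centered_add_sq hX]
  refine integral_mono
    (integrable_intervalDist_sq ((memLp_const s).add hX) (by linarith))
    ((hX.sub (memLp_const _)).add (memLp_const _)).integrable_sq fun ω => ?_
  have h := intervalDist_nonneg (A + a) (B + b) (s + X ω)
  have h' := intervalDist_le (add_le_add hA ha) (add_le_add hB hb) (s + X ω)
  calc intervalDist (A + a) (B + b) (s + X ω) ^ 2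
      ≤ |s + X ω - (c + ∫ x, X x ∂P)| ^ 2 := by gcongr
    _ = (X ω - ∫ x, X x ∂P + (s - c)) ^ 2 := by rw [sq_abs]; ring

end Moments

/-- Under independence, the upper mean squared distance of the partial sums to the intervals of
possible means is at most the sum of bounds on the variances. -/
lemma integral_intervalDist_sum_sq_le {Ω : Type*} [MeasurableSpace Ω] [TopologicalSpace Ω] {Pset : Set (ProbabilityMeasure Ω)} (hne : Pset.Nonempty)
    {n : ℕ} {X : Fin n → Ω → ℝ} (hX : ∀ i, ∀ P ∈ Pset, MemLp (X i) 2 (P : Measure Ω))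
    (hindep : IndepUnderR Pset X) {a b v : Fin n → ℝ}
    (ha : ∀ i, ∀ P ∈ Pset, a i ≤ ∫ ω, X i ω ∂(P : Measure Ω))
    (hb : ∀ i, ∀ P ∈ Pset, ∫ ω, X i ω ∂(P : Measure Ω) ≤ b i)
    (hv : ∀ i, ∀ P ∈ Pset,
      ∫ ω, (X i ω - ∫ x, X i x ∂(P : Measure Ω)) ^ 2 ∂(P : Measure Ω) ≤ v i)
    (k : ℕ) (hk : k ≤ n) {P : ProbabilityMeasure Ω} (hP : P ∈ Pset) :
    ∫ ω, intervalDist (∑ j : Fin k, a (j.castLE hk)) (∑ j : Fin k, b (j.castLE hk))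
        (∑ j : Fin k, X (j.castLE hk) ω) ^ 2 ∂(P : Measure Ω)
      ≤ ∑ j : Fin k, v (j.castLE hk) := by
  have hab : ∀ i, a i ≤ b i := fun i => (ha i P hP).trans (hb i P hP)
  induction k generalizing P with
  | zero => simp [intervalDist]
  | succ k ih =>
    have hk' : k ≤ n := (Nat.le_succ k).trans hk
    simp only [Fin.sum_univ_castSucc]
    change ∫ ω, intervalDist (∑ j : Fin k, a (j.castLE hk') + a ⟨k, hk⟩)
      (∑ j : Fin k, b (j.castLE hk') + b ⟨k, hk⟩)
      (∑ j : Fin k, X (j.castLE hk') ω + X ⟨k, hk⟩ ω) ^ 2 ∂(P : Measure Ω)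
      ≤ ∑ j : Fin k, v (j.castLE hk') + v ⟨k, hk⟩
    replace ih : ∀ Q ∈ Pset, ∫ ω, intervalDist (∑ j : Fin k, a (j.castLE hk'))
        (∑ j : Fin k, b (j.castLE hk')) (∑ j : Fin k, X (j.castLE hk') ω) ^ 2 ∂(Q : Measure Ω)
        ≤ ∑ j : Fin k, v (j.castLE hk') := fun Q hQ => ih hk' hQ
    have hAB : ∑ j : Fin k, a (j.castLE hk') ≤ ∑ j : Fin k, b (j.castLE hk') :=
      Finset.sum_le_sum fun j _ => hab _
    have hS : ∀ Q ∈ Pset, MemLp (fun ω => ∑ j : Fin k, X (j.castLE hk') ω) 2 (Q : Measure Ω) :=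
      fun Q hQ => memLp_finsetSum _ fun j _ => hX _ Q hQ
    generalize ∑ j : Fin k, a (j.castLE hk') = A at ih hAB ⊢
    generalize ∑ j : Fin k, b (j.castLE hk') = B at ih hAB ⊢
    have hAB' : A + a ⟨k, hk⟩ ≤ B + b ⟨k, hk⟩ := add_le_add hAB (hab _)
    have hstep : ∀ Q ∈ Pset, ∀ s, ∫ ω, intervalDist (A + a ⟨k, hk⟩) (B + b ⟨k, hk⟩)
        (s + X ⟨k, hk⟩ ω) ^ 2 ∂(Q : Measure Ω) ≤ intervalDist A B s ^ 2 + v ⟨k, hk⟩ :=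
      fun Q hQ s => (integral_intervalDist_add_sq_le (hX _ Q hQ) (ha _ Q hQ) (hb _ Q hQ) hAB
        s).trans (add_le_add_right (hv _ Q hQ) _)
    rcases k with _ | k
    · have h0 := hstep P hP 0
      have hz : intervalDist A B 0 ^ 2 ≤ 0 := by simpa using ih P hP
      simp only [Finset.univ_eq_empty, Finset.sum_empty]
      linarith
    set A' := A + a ⟨k + 1, hk⟩
    set B' := B + b ⟨k + 1, hk⟩
    have hint : ∀ Q ∈ Pset, Integrable (fun ω => intervalDist A' B'
        (∑ j : Fin (k + 1), X (j.castLE hk') ω + X ⟨k + 1, hk⟩ ω) ^ 2) (Q : Measure Ω) :=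
      fun Q hQ => integrable_intervalDist_sq ((hS Q hQ).add (hX _ Q hQ)) hAB'
    have hmin : ∀ (s : ℝ) (N : ℕ),
        min (intervalDist A' B' s) N ^ 2 ≤ intervalDist A' B' s ^ 2 := fun s N => by
      have := intervalDist_nonneg A' B' s
      gcongr
      exact min_le_left _ _
    refine le_of_tendsto' (tendsto_integral_of_dominated_convergence
      (F := fun (N : ℕ) ω => min (intervalDist A' B'
        (∑ j : Fin (k + 1), X (j.castLE hk') ω + X ⟨k + 1, hk⟩ ω)) N ^ 2) _ (fun N => ?_) (hint P hP)
        (fun N => Filter.Eventually.of_forall fun ω => ?_)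
        (Filter.Eventually.of_forall fun ω => ?_)) fun N => ?_
    · exact ((((continuous_intervalDist A' B').min continuous_const).pow 2)).comp_aestronglyMeasurable
        ((hS P hP).add (hX _ P hP)).1
    · rw [Real.norm_of_nonneg (sq_nonneg _)]
      exact hmin _ N
    · refine tendsto_const_nhds.congr' ?_
      obtain ⟨N₀, hN₀⟩ := exists_nat_ge (intervalDist A' B'
        (∑ j : Fin (k + 1), X (j.castLE hk') ω + X ⟨k + 1, hk⟩ ω))
      filter_upwards [Filter.eventually_ge_atTop N₀] with N hN
      rw [min_eq_left (hN₀.trans (by exact_mod_cast hN))]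
    · have hle : ∀ Q ∈ Pset, ∀ s, ∫ ω, min (intervalDist A' B' (s + X ⟨k + 1, hk⟩ ω)) N ^ 2
          ∂(Q : Measure Ω) ≤ intervalDist A B s ^ 2 + v ⟨k + 1, hk⟩ := fun Q hQ s =>
        (integral_mono_of_nonneg (Filter.Eventually.of_forall fun ω => sq_nonneg _)
          (integrable_intervalDist_sq ((memLp_const s).add (hX _ Q hQ)) hAB')
          (Filter.Eventually.of_forall fun ω => hmin _ N)).trans (hstep Q hQ s)
      have hind := hindep k hk _ (isBLip_min_intervalDist_sq hAB' N.cast_nonneg (k + 1))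
      refine (integral_le_hatE (C := N ^ 2) (fun Q _ => ?_) hP).trans (hind.le.trans
        (hatE_le hne fun Q hQ => ?_))
      · refine (integral_mono_of_nonneg (Filter.Eventually.of_forall fun ω => sq_nonneg _)
          (integrable_const ((N : ℝ) ^ 2)) (Filter.Eventually.of_forall fun ω => ?_)).trans
          (by simp)
        have := intervalDist_nonneg A' B'
          (∑ j : Fin (k + 1), X (j.castLE hk') ω + X ⟨k + 1, hk⟩ ω)
        dsimp only
        gcongr
        exact min_le_right _ _
      · have hSint := integrable_intervalDist_sq (hS Q hQ) hAB
        calc _ ≤ ∫ ω, (intervalDist A B (∑ j : Fin (k + 1), X (j.castLE hk') ω) ^ 2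
              + v ⟨k + 1, hk⟩) ∂(Q : Measure Ω) :=
              integral_mono_of_nonneg
                (Filter.Eventually.of_forall fun ω => hatE_nonneg fun ω' => sq_nonneg _)
                (hSint.add (integrable_const _))
                (Filter.Eventually.of_forall fun ω => hatE_le hne fun R hR => hle R hR _)
          _ = ∫ ω, intervalDist A B (∑ j : Fin (k + 1), X (j.castLE hk') ω) ^ 2
              ∂(Q : Measure Ω) + v ⟨k + 1, hk⟩ := by
              rw [integral_add hSint (integrable_const _)]; simp
          _ ≤ _ := add_le_add_left (ih Q hQ) _

/-- the one-dimensional sample-mean inequality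
`Ê[((S̄ − μ₊)⁺ + (S̄ − μ₋)⁻)²] ≤ σ̄_n²/n` for independent real random variables
`X_1, …, X_n` (0-indexed here) with uniformly bounded second moments. -/
theorem one_dim_sample_mean_inequality
    {Ω : Type*} [MetricSpace Ω] [CompleteSpace Ω] [TopologicalSpace.SeparableSpace Ω]
    [MeasurableSpace Ω] [BorelSpace Ω]
    {n : ℕ} (hn : 0 < n) (Pset : Set (ProbabilityMeasure Ω))
    (hne : Pset.Nonempty) (hconv : ConvexPM Pset) (hcomp : IsCompact Pset)
    (X : Fin n → Ω → ℝ)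
    (hmeas : ∀ i, Measurable (X i))
    (hmom : ∀ i : Fin n, ∃ C : ℝ, ∀ P ∈ Pset,
      Integrable (fun ω => (X i ω) ^ 2) ((P : ProbabilityMeasure Ω) : Measure Ω) ∧
      ∫ ω, (X i ω) ^ 2 ∂((P : ProbabilityMeasure Ω) : Measure Ω) ≤ C)
    (hindep : IndepUnderR Pset X)
    (μp μm : ℝ)
    (hμp : μp = (n : ℝ)⁻¹ * ∑ i, hatE Pset (X i))
    (hμm : μm = -((n : ℝ)⁻¹ * ∑ i, hatE Pset (fun ω => -X i ω)))
    (σbar2 : ℝ)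
    (hσ : σbar2 = ⨆ i : Fin n, sInf {v : ℝ |
      ∃ θ ∈ Set.Icc (-(hatE Pset (fun ω => -X i ω))) (hatE Pset (X i)),
        v = hatE Pset (fun ω => |X i ω - θ| ^ 2)}) :
    hatE Pset (fun ω =>
        (max ((n : ℝ)⁻¹ * ∑ i, X i ω - μp) 0
          + max (-((n : ℝ)⁻¹ * ∑ i, X i ω - μm)) 0) ^ 2)
      ≤ σbar2 / n := by
  have hX : ∀ i, ∀ P ∈ Pset, MemLp (X i) 2 ((P : ProbabilityMeasure Ω) : Measure Ω) := by
    intro i P hP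
    obtain ⟨C, hC⟩ := hmom i
    exact (memLp_two_iff_integrable_sq (hmeas i).aestronglyMeasurable).2 (hC P hP).1
  have hb : ∀ i, ∀ P ∈ Pset, ∫ ω, X i ω ∂(P : Measure Ω) ≤ hatE Pset (X i) := by
    intro i P hP
    obtain ⟨C, hC⟩ := hmom i
    refine integral_le_hatE (C := C + 1) (fun Q hQ => ?_) hP
    calc ∫ ω, X i ω ∂(Q : Measure Ω) ≤ ∫ ω, (X i ω ^ 2 + 1) ∂(Q : Measure Ω) :=
          integral_mono ((hX i Q hQ).integrable one_le_two)
            ((hC Q hQ).1.add (integrable_const _)) fun ω => by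
              dsimp only; nlinarith [sq_nonneg (X i ω - 1)]
      _ = ∫ ω, X i ω ^ 2 ∂(Q : Measure Ω) + 1 := by
          rw [integral_add (hC Q hQ).1 (integrable_const _)]; simp
      _ ≤ C + 1 := by linarith [(hC Q hQ).2]
  have ha : ∀ i, ∀ P ∈ Pset,
      -(hatE Pset (fun ω => -X i ω)) ≤ ∫ ω, X i ω ∂(P : Measure Ω) := by
    intro i P hP
    obtain ⟨C, hC⟩ := hmom i
    have := integral_le_hatE (f := fun ω => -X i ω) (C := C + 1) (fun Q hQ => ?_) hP
    · rw [integral_neg] at this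
      linarith
    calc ∫ ω, -X i ω ∂(Q : Measure Ω) ≤ ∫ ω, (X i ω ^ 2 + 1) ∂(Q : Measure Ω) :=
          integral_mono ((hX i Q hQ).integrable one_le_two).neg
            ((hC Q hQ).1.add (integrable_const _)) fun ω => by
              dsimp only; nlinarith [sq_nonneg (X i ω + 1)]
      _ = ∫ ω, X i ω ^ 2 ∂(Q : Measure Ω) + 1 := by
          rw [integral_add (hC Q hQ).1 (integrable_const _)]; simp
      _ ≤ C + 1 := by linarith [(hC Q hQ).2]
  have hv : ∀ i, ∀ P ∈ Pset,
      ∫ ω, (X i ω - ∫ x, X i x ∂(P : Measure Ω)) ^ 2 ∂(P : Measure Ω) ≤ σbar2 := by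
    intro i P hP
    rw [hσ]
    refine le_trans ?_ (le_ciSup (Set.finite_range _).bddAbove i)
    refine le_csInf ⟨_, _, ⟨le_rfl, (ha i P hP).trans (hb i P hP)⟩, rfl⟩ ?_
    rintro _ ⟨θ, -, rfl⟩
    obtain ⟨C, hC⟩ := hmom i
    calc ∫ ω, (X i ω - ∫ x, X i x ∂(P : Measure Ω)) ^ 2 ∂(P : Measure Ω)
        ≤ ∫ ω, (X i ω - ∫ x, X i x ∂(P : Measure Ω)
            + (∫ x, X i x ∂(P : Measure Ω) - θ)) ^ 2 ∂(P : Measure Ω) := by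
          rw [integral_centered_add_sq (hX i P hP)]
          linarith [sq_nonneg (∫ x, X i x ∂(P : Measure Ω) - θ)]
      _ = ∫ ω, |X i ω - θ| ^ 2 ∂(P : Measure Ω) := by simp
      _ ≤ _ := integral_le_hatE (C := 2 * C + 2 * θ ^ 2) (fun Q hQ => ?_) hP
    calc ∫ ω, |X i ω - θ| ^ 2 ∂(Q : Measure Ω)
        ≤ ∫ ω, (2 * X i ω ^ 2 + 2 * θ ^ 2) ∂(Q : Measure Ω) := by
          refine integral_mono_of_nonneg (Filter.Eventually.of_forall fun ω => sq_nonneg _)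
            (((hC Q hQ).1.const_mul 2).add (integrable_const _))
            (Filter.Eventually.of_forall fun ω => ?_)
          dsimp only
          rw [sq_abs]
          nlinarith [sq_nonneg (X i ω + θ)]
      _ = 2 * ∫ ω, X i ω ^ 2 ∂(Q : Measure Ω) + 2 * θ ^ 2 := by
          rw [integral_add ((hC Q hQ).1.const_mul 2) (integrable_const _), integral_const_mul]
          simp
      _ ≤ 2 * C + 2 * θ ^ 2 := by linarith [(hC Q hQ).2]
  have hn' : (0 : ℝ) < n := by exact_mod_cast hn
  refine hatE_le hne fun P hP => ?_
  have hmain := integral_intervalDist_sum_sq_le hne hX hindep ha hb hv n le_rfl hP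
  simp only [Fin.castLE_rfl, id, Finset.sum_const, Finset.card_univ, Fintype.card_fin,
    nsmul_eq_mul] at hmain
  have hscale : ∀ ω, (max ((n : ℝ)⁻¹ * ∑ i, X i ω - μp) 0
      + max (-((n : ℝ)⁻¹ * ∑ i, X i ω - μm)) 0) ^ 2
      = ((n : ℝ)⁻¹) ^ 2 * intervalDist (∑ i, -(hatE Pset (fun ω => -X i ω)))
          (∑ i, hatE Pset (X i)) (∑ i, X i ω) ^ 2 := by
    intro ω
    have hinv : (0 : ℝ) ≤ (n : ℝ)⁻¹ := by positivity
    rw [← mul_pow, intervalDist, mul_add, mul_max_of_nonneg _ _ hinv, mul_max_of_nonneg _ _ hinv,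
      hμp, hμm, Finset.sum_neg_distrib]
    ring_nf
  simp_rw [hscale]
  rw [integral_const_mul]
  calc ((n : ℝ)⁻¹) ^ 2 * _ ≤ ((n : ℝ)⁻¹) ^ 2 * (n * σbar2) := by gcongr
    _ = σbar2 / n := by field_simp
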